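/- Let n ≥ 2 and let a ≠ b be two indices in {1,…,n}. Then for every integer j ≥ 0, the even Ext group Ext^{2j}_B(O^a, O^b) vanishes; in particular Hom_B(O^a, O^b) = 0. (This is the vanishing of the even-degree part of the paper's computation H^*(Hom(O^a, O^b)) ≅ A[u]/(z_a, z_b)[-1].) -/

import Mathlib

open CategoryTheory MvPolynomial

noncomputable section

set_option maxHeartbeats 1000000
set_option synthInstance.maxHeartbeats 1000000

/-- `B = k[z_1,…,z_n]/(z_1⋯z_n)`, the coordinate ring of the union of
coordinate hyperplanes `X_{n-1} ⊂ 𝔸^n`. -/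
abbrev Bquot (k : Type) [Field k] (n : ℕ) : Type :=
  MvPolynomial (Fin n) k ⧸
    Ideal.span ({∏ b : Fin n, X b} : Set (MvPolynomial (Fin n) k))

/-- `O^a = B/(z_a)`, the structure sheaf of the coordinate hyperplane
`{z_a = 0}` as an object of `Coh(X_{n-1}) = Mod(B)`. -/
abbrev hyperplaneSheaf (k : Type) [Field k] (n : ℕ) (a : Fin n) :
    ModuleCat (Bquot k n) :=
  ModuleCat.of (Bquot k n)
    (Bquot k n ⧸
      Ideal.span
        ({Ideal.Quotient.mk
            (Ideal.span ({∏ b : Fin n, X b} : Set (MvPolynomial (Fin n) k)))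
            (X a)} : Set (Bquot k n)))


/-- Multiplication by `r` on the free module of rank one. -/
def mulHom (R : Type) [CommRing R] (r : R) : ModuleCat.of R R ⟶ ModuleCat.of R R :=
  ModuleCat.ofHom (LinearMap.lsmul R R r)

lemma mulHom_apply {R : Type} [CommRing R] (r s : R) :
    (mulHom R r).hom s = r * s := rfl

lemma mulHom_comp {R : Type} [CommRing R] {r s : R} (h : r * s = 0) :
    mulHom R r ≫ mulHom R s = 0 := by
  apply ModuleCat.hom_ext
  apply LinearMap.ext
  intro t
  change s * (r * t) = 0
  rw [← mul_assoc, mul_comm s r, h, zero_mul]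

/-- The two-periodic complex `⋯ ⟶ R --x--> R --w--> R --x--> R`. -/
def perComplex (R : Type) [CommRing R] (x w : R) (h : w * x = 0) :
    ChainComplex (ModuleCat R) ℕ :=
  HomologicalComplex.alternatingConst (ModuleCat.of R R) (φ := mulHom R w) (ψ := mulHom R x)
    (mulHom_comp h) (mulHom_comp (by rw [mul_comm, h])) fun _ _ => ComplexShape.down_nat_odd_add

lemma perComplex_d_odd (R : Type) [CommRing R] (x w : R) (h : w * x = 0) (i : ℕ) (hi : Even i) :
    (perComplex R x w h).d (i + 1) i = mulHom R x := by
  have h1 : ¬ Even (i + 1) := by simpa [Nat.even_add_one] using hi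
  exact (dif_pos (c := (ComplexShape.down ℕ).Rel (i + 1) i) rfl).trans (dif_neg h1)

lemma perComplex_d_even (R : Type) [CommRing R] (x w : R) (h : w * x = 0) (i : ℕ) (hi : ¬ Even i) :
    (perComplex R x w h).d (i + 1) i = mulHom R w := by
  have h1 : Even (i + 1) := by simpa [Nat.even_add_one] using hi
  exact (dif_pos (c := (ComplexShape.down ℕ).Rel (i + 1) i) rfl).trans (dif_pos h1)

/-- The quotient map `R ⟶ R/(x)`. -/
def quotHom (R : Type) [CommRing R] (x : R) :
    ModuleCat.of R R ⟶ ModuleCat.of R (R ⧸ Ideal.span ({x} : Set R)) :=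
  ModuleCat.ofHom (Submodule.mkQ _)

lemma mulHom_quotHom (R : Type) [CommRing R] (x : R) : mulHom R x ≫ quotHom R x = 0 := by
  apply ModuleCat.hom_ext
  apply LinearMap.ext
  intro t
  change Ideal.Quotient.mk _ (x * t) = 0
  exact Ideal.Quotient.eq_zero_iff_mem.2 (Ideal.mul_mem_right _ _ (Ideal.mem_span_singleton_self x))

lemma perComplex_aug (R : Type) [CommRing R] (x w : R) (h : w * x = 0) :
    (perComplex R x w h).d 1 0 ≫ quotHom R x = 0 := by
  have := perComplex_d_odd R x w h 0 (by simp)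
  rw [zero_add] at this
  rw [this]
  exact mulHom_quotHom R x

/-- The augmentation. -/
def perπ (R : Type) [CommRing R] (x w : R) (h : w * x = 0) :
    perComplex R x w h ⟶ (ChainComplex.single₀ (ModuleCat R)).obj
      (ModuleCat.of R (R ⧸ Ideal.span ({x} : Set R))) :=
  ((perComplex R x w h).toSingle₀Equiv _).symm ⟨quotHom R x, perComplex_aug R x w h⟩

lemma perπ_f (R : Type) [CommRing R] (x w : R) (h : w * x = 0) :
    (perπ R x w h).f 0 = quotHom R x :=
  ChainComplex.toSingle₀Equiv_symm_apply_f_zero _ _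

lemma quotHom_exact (R : Type) [CommRing R] (x : R) (r : R) (hr : (quotHom R x).hom r = 0) :
    ∃ s : R, (mulHom R x).hom s = r := by
  have hr2 : r ∈ Ideal.span ({x} : Set R) := Ideal.Quotient.eq_zero_iff_mem.1 hr
  obtain ⟨s, hs⟩ := Ideal.mem_span_singleton.1 hr2
  exact ⟨s, hs.symm⟩

lemma quotHom_epi (R : Type) [CommRing R] (x : R) : Epi (quotHom R x) := by
  rw [ModuleCat.epi_iff_surjective]
  exact Submodule.mkQ_surjective _

lemma per_quasiIso (R : Type) [CommRing R] (x w : R) (h : w * x = 0)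
    (hx : ∀ r, x * r = 0 → ∃ s, w * s = r) (hw : ∀ r, w * r = 0 → ∃ s, x * s = r) :
    QuasiIso (perπ R x w h) where
  quasiIsoAt m := by
    cases m with
    | zero =>
      rw [ChainComplex.quasiIsoAt₀_iff, ShortComplex.quasiIso_iff_of_zeros' _ rfl rfl rfl]
      constructor
      · rw [ShortComplex.moduleCat_exact_iff]
        intro r hr
        have hr' : (quotHom R x).hom r = 0 := by
          rw [← perπ_f R x w h]; exact hr
        obtain ⟨s, hs⟩ := quotHom_exact R x r hr'
        refine ⟨s, ?_⟩
        have := perComplex_d_odd R x w h 0 (by simp)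
        rw [zero_add] at this
        change ((perComplex R x w h).d 1 0).hom s = r
        rw [this]; exact hs
      · change Epi ((perπ R x w h).f 0)
        rw [perπ_f]
        exact quotHom_epi R x
    | succ m =>
      rw [quasiIsoAt_iff_exactAt' (hL := ChainComplex.exactAt_succ_single_obj ..),
          HomologicalComplex.exactAt_iff' _ (m + 2) (m + 1) m (by simp) (by simp),
          ShortComplex.moduleCat_exact_iff]
      intro r hr
      change ((perComplex R x w h).d (m+1) m).hom r = 0 at hr
      change ∃ s, ((perComplex R x w h).d (m+1+1) (m+1)).hom s = r
      by_cases hm : Even m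
      · rw [perComplex_d_odd R x w h m hm] at hr
        rw [perComplex_d_even R x w h (m+1) (by simpa [Nat.even_add_one] using hm)]
        exact hx r hr
      · rw [perComplex_d_even R x w h m hm] at hr
        rw [perComplex_d_odd R x w h (m+1) (by simpa [Nat.even_add_one] using hm)]
        exact hw r hr

/-- The two-periodic free resolution of `R/(x)`. -/
def perRes (R : Type) [CommRing R] (x w : R) (h : w * x = 0)
    (hx : ∀ r, x * r = 0 → ∃ s, w * s = r) (hw : ∀ r, w * r = 0 → ∃ s, x * s = r) :
    ProjectiveResolution (ModuleCat.of R (R ⧸ Ideal.span ({x} : Set R))) where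
  complex := perComplex R x w h
  projective _ := (ModuleCat.of R R).projective_of_free (Module.Basis.singleton Unit R)
  π := perπ R x w h
  quasiIso := per_quasiIso R x w h hx hw

lemma ext_even_subsingleton (k : Type) [Field k] (R : Type) [CommRing R] [Algebra k R]
    (x w : R) (h : w * x = 0)
    (hx : ∀ r, x * r = 0 → ∃ s, w * s = r) (hw : ∀ r, w * r = 0 → ∃ s, x * s = r)
    (N : ModuleCat R) (hN : ∀ m : N, x • m = 0 → m = 0) (j : ℕ) :
    Subsingleton (((Ext k (ModuleCat R) (2 * j)).obj
      (Opposite.op (ModuleCat.of R (R ⧸ Ideal.span ({x} : Set R))))).obj N) := by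
  rw [← ModuleCat.isZero_iff_subsingleton]
  refine Limits.IsZero.of_iso ?_ ((perRes R x w h hx hw).isoExt (2 * j) N)
  rw [← HomologicalComplex.exactAt_iff_isZero_homology,
    HomologicalComplex.exactAt_iff' _ _ (2 * j) (2 * j + 1) rfl (by simp),
    ShortComplex.moduleCat_exact_iff]
  intro f hf
  change (perComplex R x w h).X (2 * j) ⟶ N at f
  refine ⟨0, ?_⟩
  rw [map_zero]
  change (perComplex R x w h).d (2 * j + 1) (2 * j) ≫ f = 0 at hf
  rw [perComplex_d_odd R x w h (2 * j) (by simp)] at hf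
  symm
  change ModuleCat.of R R ⟶ N at f
  change f = 0
  apply ModuleCat.hom_ext
  apply LinearMap.ext
  intro r
  apply hN
  have h2 : f.hom ((mulHom R x).hom r) = 0 := by
    have := congrArg (fun g => (ModuleCat.Hom.hom g) r) hf
    exact this
  rw [mulHom_apply] at h2
  rw [← h2, ← smul_eq_mul, map_smul]

lemma hom_eq_zero_of_regular (R : Type) [CommRing R] (x : R)
    (N : ModuleCat R) (hN : ∀ m : N, x • m = 0 → m = 0)
    (f : ModuleCat.of R (R ⧸ Ideal.span ({x} : Set R)) ⟶ N) : f = 0 := by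
  apply ModuleCat.hom_ext
  apply LinearMap.ext
  intro r
  apply hN
  rw [← map_smul]
  have : x • r = 0 := by
    obtain ⟨r, rfl⟩ := Ideal.Quotient.mk_surjective r
    change Ideal.Quotient.mk _ (x * r) = 0
    exact Ideal.Quotient.eq_zero_iff_mem.2
      (Ideal.mul_mem_right _ _ (Ideal.mem_span_singleton_self x))
  rw [this, map_zero]

section
variable (k : Type) [Field k] (n : ℕ)

/-- The class of a polynomial in `B`. -/
abbrev toB : MvPolynomial (Fin n) k →+* Bquot k n := Ideal.Quotient.mk _

/-- The product of all variables but `z_a`. -/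
abbrev Wa (a : Fin n) : MvPolynomial (Fin n) k := ∏ b ∈ Finset.univ.erase a, X b

lemma Wa_mul (a : Fin n) : Wa k n a * X a = ∏ b : Fin n, X b :=
  Finset.prod_erase_mul _ _ (Finset.mem_univ a)

lemma toB_eq_zero (p : MvPolynomial (Fin n) k) :
    toB k n p = 0 ↔ (∏ b : Fin n, X b) ∣ p := by
  rw [Ideal.Quotient.eq_zero_iff_mem, Ideal.mem_span_singleton]

lemma Wa_ne_zero (a : Fin n) : Wa k n a ≠ 0 :=
  Finset.prod_ne_zero_iff.2 fun _ _ => X_ne_zero _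

lemma B_ann_X (a : Fin n) (r : Bquot k n) (hr : toB k n (X a) * r = 0) :
    ∃ s, toB k n (Wa k n a) * s = r := by
  obtain ⟨p, rfl⟩ := Ideal.Quotient.mk_surjective r
  rw [← map_mul, toB_eq_zero, ← Wa_mul k n a, mul_comm] at hr
  obtain ⟨q, rfl⟩ := (mul_dvd_mul_iff_left (X_ne_zero a)).1 hr
  exact ⟨toB k n q, (map_mul _ _ _).symm⟩

lemma B_ann_Wa (a : Fin n) (r : Bquot k n) (hr : toB k n (Wa k n a) * r = 0) :
    ∃ s, toB k n (X a) * s = r := by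
  obtain ⟨p, rfl⟩ := Ideal.Quotient.mk_surjective r
  rw [← map_mul, toB_eq_zero, ← Wa_mul k n a] at hr
  obtain ⟨q, rfl⟩ := (mul_dvd_mul_iff_left (Wa_ne_zero k n a)).1 hr
  exact ⟨toB k n q, (map_mul _ _ _).symm⟩

lemma B_regular (a b : Fin n) (hab : a ≠ b) (m : hyperplaneSheaf k n b)
    (hm : toB k n (X a) • m = 0) : m = 0 := by
  obtain ⟨r, rfl⟩ := Ideal.Quotient.mk_surjective m
  obtain ⟨p, rfl⟩ := Ideal.Quotient.mk_surjective r
  change Ideal.Quotient.mk _ (toB k n (X a) * toB k n p) = 0 at hm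
  rw [Ideal.Quotient.eq_zero_iff_mem, Ideal.mem_span_singleton] at hm
  apply Ideal.Quotient.eq_zero_iff_mem.2
  rw [Ideal.mem_span_singleton]
  obtain ⟨s, hs⟩ := hm
  obtain ⟨q, rfl⟩ := Ideal.Quotient.mk_surjective s
  have h1 : toB k n (X a * p - X b * q) = 0 := by
    rw [map_sub, map_mul, map_mul, sub_eq_zero]; exact hs
  rw [toB_eq_zero] at h1
  have h2 : (X b : MvPolynomial (Fin n) k) ∣ X a * p - X b * q :=
    (Dvd.intro_left _ (Wa_mul k n b)).trans h1
  have h3 : (X b : MvPolynomial (Fin n) k) ∣ X a * p := by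
    have := dvd_add h2 (dvd_mul_right (X b) q)
    rwa [sub_add_cancel] at this
  rcases (X_prime (i := b) (R := k)).dvd_or_dvd h3 with h4 | h4
  · exact absurd (X_dvd_X.1 h4) (by simpa using hab.symm)
  · exact map_dvd (toB k n) h4

end

/-- for `a ≠ b` and every `j ≥ 0`, the even Ext group
`Ext^{2j}_B(O^a, O^b)` vanishes; in particular `Hom_B(O^a, O^b) = 0`. -/
theorem ext_even_hyperplane_distinct_vanishes
    (k : Type) [Field k] (n : ℕ) (hn : 2 ≤ n) (a b : Fin n) (hab : a ≠ b) :
    (∀ j : ℕ,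
      Subsingleton
        (((Ext k (ModuleCat (Bquot k n)) (2 * j)).obj
            (Opposite.op (hyperplaneSheaf k n a))).obj (hyperplaneSheaf k n b))) ∧
    ∀ f : hyperplaneSheaf k n a ⟶ hyperplaneSheaf k n b, f = 0 := by
  have h0 : toB k n (Wa k n a) * toB k n (X a) = 0 := by
    rw [← map_mul, toB_eq_zero, Wa_mul]
  exact ⟨fun j => ext_even_subsingleton k (Bquot k n) (toB k n (X a)) (toB k n (Wa k n a)) h0
      (B_ann_X k n a) (B_ann_Wa k n a) (hyperplaneSheaf k n b) (B_regular k n a b hab) j,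
    fun f => hom_eq_zero_of_regular (Bquot k n) (toB k n (X a)) (hyperplaneSheaf k n b)
      (B_regular k n a b hab) f⟩

end
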